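/- Let P be a real orthogonal n×n matrix, λ₁ ≥ λ₂ ≥ … ≥ λ_n > 0 real numbers, A = P·diag(λ₁,…,λ_n)·Pᵀ, and for λ₂ ≤ μ̄ ≤ λ₁ set R(μ̄) = P·diag(max(μ̄−λ₁,0),…,max(μ̄−λ_n,0))·Pᵀ. Then the condition number Cond(A+R(μ̄)) = λ₁/μ̄ is minimized over μ̄ ∈ [λ₂, λ₁] at μ̄ = λ₁, where it attains the value 1, the minimal possible condition number; hence this choice of regularization matrix maximizes the generalizability of the neural network. -/

import Mathlib

/-- The condition number of a real symmetric positive definite matrix: the ratio of its largest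
to its smallest eigenvalue, formalized via the real spectrum. -/
noncomputable def matrixCond {n : ℕ} (M : Matrix (Fin n) (Fin n) ℝ) : ℝ :=
  sSup (spectrum ℝ M) / sInf (spectrum ℝ M)

theorem spectrum_orthogonal_conj_diagonal {n : ℕ} {P : Matrix (Fin n) (Fin n) ℝ}
    (hP : P ∈ Matrix.orthogonalGroup (Fin n) ℝ) (d : Fin n → ℝ) :
    spectrum ℝ (P * Matrix.diagonal d * P.transpose) = Set.range d := by
  have h := Unitary.spectrum_star_right_conjugate (R := ℝ) (a := Matrix.diagonal d) (U := ⟨P, hP⟩)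
  rw [spectrum_diagonal] at h
  exact h

theorem matrixCond_of_spectrum_eq_pair {n : ℕ} {M : Matrix (Fin n) (Fin n) ℝ} {a b : ℝ}
    (hab : b ≤ a) (h : spectrum ℝ M = {a, b}) : matrixCond M = a / b := by
  rw [matrixCond, h, csSup_pair, csInf_pair, max_eq_left hab, min_eq_right hab]

/-- Raising the entries of a tuple to a level which is exceeded by at most one entry, and attained
from below by some entry, leaves only that one entry and the level. -/
theorem range_max_eq_pair {ι : Type*} {l : ι → ℝ} {μ : ℝ} {i j : ι}
    (hi : μ ≤ l i) (hj : l j ≤ μ) (h : ∀ k, k ≠ i → l k ≤ μ) :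
    Set.range (fun k => max (l k) μ) = {l i, μ} := by
  ext x
  simp only [Set.mem_range, Set.mem_insert_iff, Set.mem_singleton_iff]
  constructor
  · rintro ⟨k, rfl⟩
    rcases eq_or_ne k i with rfl | hk
    · exact Or.inl (max_eq_left hi)
    · exact Or.inr (max_eq_right (h k hk))
  · rintro (rfl | rfl)
    · exact ⟨i, max_eq_left hi⟩
    · exact ⟨j, max_eq_right hj⟩

/-- For `A = P diag(λ) Pᵀ` with `P` orthogonal and `λ₁ ≥ … ≥ λ_n > 0`, and the
regularization matrices `R(μ̄) = P diag(max(μ̄−λᵢ,0)) Pᵀ` for `μ̄ ∈ [λ₂, λ₁]`: the condition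
number `Cond(A+R(μ̄)) = λ₁/μ̄` is minimized over `[λ₂, λ₁]` at `μ̄ = λ₁`, where it attains the
value `1`, the minimal possible condition number. -/
theorem cond_minimized_at_top_eigenvalue
    (n : ℕ) (hn : 2 ≤ n) (P : Matrix (Fin n) (Fin n) ℝ)
    (hP : P ∈ Matrix.orthogonalGroup (Fin n) ℝ)
    (l : Fin n → ℝ) (hl : Antitone l) (hlpos : ∀ i, 0 < l i)
    (A : Matrix (Fin n) (Fin n) ℝ) (hA : A = P * Matrix.diagonal l * P.transpose)
    (R : ℝ → Matrix (Fin n) (Fin n) ℝ)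
    (hR : ∀ μ : ℝ, R μ = P * Matrix.diagonal (fun i => max (μ - l i) 0) * P.transpose) :
    (∀ μ : ℝ, μ ∈ Set.Icc (l ⟨1, by omega⟩) (l ⟨0, by omega⟩) →
        matrixCond (A + R μ) = l ⟨0, by omega⟩ / μ) ∧
      matrixCond (A + R (l ⟨0, by omega⟩)) = 1 ∧
      ∀ μ : ℝ, μ ∈ Set.Icc (l ⟨1, by omega⟩) (l ⟨0, by omega⟩) →
        matrixCond (A + R (l ⟨0, by omega⟩)) ≤ matrixCond (A + R μ) := by
  have key : ∀ μ : ℝ, μ ∈ Set.Icc (l ⟨1, by omega⟩) (l ⟨0, by omega⟩) →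
      matrixCond (A + R μ) = l ⟨0, by omega⟩ / μ := by
    rintro μ ⟨h₁, h₀⟩
    refine matrixCond_of_spectrum_eq_pair h₀ ?_
    have hd : (fun i => l i + max (μ - l i) 0) = fun i => max (l i) μ := by
      funext i
      rw [← max_add_add_left, add_sub_cancel, add_zero, max_comm]
    rw [hA, hR, ← add_mul, ← mul_add, Matrix.diagonal_add, hd,
      spectrum_orthogonal_conj_diagonal hP, range_max_eq_pair h₀ h₁]
    intro k hk
    have hpos : 1 ≤ k.val := Nat.one_le_iff_ne_zero.2 fun h => hk (Fin.ext h)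
    exact (hl (Fin.mk_le_of_le_val hpos)).trans h₁
  have hone : matrixCond (A + R (l ⟨0, by omega⟩)) = 1 := by
    rw [key _ ⟨hl (Fin.mk_le_mk.2 zero_le_one), le_rfl⟩, div_self (hlpos _).ne']
  refine ⟨key, hone, fun μ hμ => ?_⟩
  rw [hone, key μ hμ]
  exact (one_le_div ((hlpos _).trans_le hμ.1)).2 hμ.2
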